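/- For every s ∈ (0,1) and every dimension n ≥ 1, one has ∫_{ℝⁿ} (C_s − S̃_s(ξ)) |ξ|^{2s} dξ < +∞, where the integrand is nonnegative since S̃_s(ξ) ≤ C_s for all ξ. (This is the key finiteness claim, equation (3.2)/(finite:int), in the proof of Lemma 4.1.) -/

import Mathlib

open MeasureTheory Filter

/-- Modified Bessel function of the first kind, defined by its power series. -/
noncomputable def besselI (ν x : ℝ) : ℝ :=
  ∑' k : ℕ, (x / 2) ^ (2 * (k : ℝ) + ν) / ((k.factorial : ℝ) * Real.Gamma ((k : ℝ) + ν + 1))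

noncomputable def Cs (s : ℝ) : ℝ := (2 : ℝ) ^ (1 - 2 * s) * Real.Gamma (1 - s) / Real.Gamma s

open Classical in
noncomputable def Stilde {n : ℕ} (s : ℝ) (ξ : EuclideanSpace ℝ (Fin n)) : ℝ :=
  if ξ = 0 then 0 else Cs s * besselI (1 - s) ‖ξ‖ / besselI (s - 1) ‖ξ‖

noncomputable def symbolS {n : ℕ} (s : ℝ) (ξ : EuclideanSpace ℝ (Fin n)) : ℝ :=
  ‖ξ‖ ^ (2 * s) * Stilde s ξ

/-- Coefficients of the entire function `besselSeries`. -/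
noncomputable def besselCoeff (ν : ℝ) (k : ℕ) : ℝ :=
  ((k.factorial : ℝ) * Real.Gamma ((k : ℝ) + ν + 1))⁻¹

/-- The entire function `g_ν` with `I_ν(x) = (x / 2) ^ ν * g_ν((x / 2) ^ 2)`. -/
noncomputable def besselSeries (ν z : ℝ) : ℝ := ∑' k : ℕ, besselCoeff ν k * z ^ k

lemma besselCoeff_pos {ν : ℝ} (hν : -1 < ν) (k : ℕ) : 0 < besselCoeff ν k := by
  have hk : (0 : ℝ) ≤ k := k.cast_nonneg
  have := Real.Gamma_pos_of_pos (show (0 : ℝ) < (k : ℝ) + ν + 1 by linarith)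
  unfold besselCoeff
  positivity

lemma succ_mul_besselCoeff_succ (ν : ℝ) (k : ℕ) :
    ((k : ℝ) + 1) * besselCoeff ν (k + 1) = besselCoeff (ν + 1) k := by
  have hk : (k : ℝ) + 1 ≠ 0 := by positivity
  unfold besselCoeff
  rw [Nat.factorial_succ]
  push_cast
  rw [show (k : ℝ) + 1 + ν + 1 = (k : ℝ) + (ν + 1) + 1 by ring, mul_assoc, mul_inv ((k : ℝ) + 1),
    mul_inv_cancel_left₀ hk]

lemma mul_besselCoeff_add_one {ν : ℝ} (hν : -1 < ν) (k : ℕ) :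
    ((k : ℝ) + ν + 1) * besselCoeff (ν + 1) k = besselCoeff ν k := by
  have hk : (0 : ℝ) ≤ k := k.cast_nonneg
  have h : (k : ℝ) + ν + 1 ≠ 0 := by linarith
  unfold besselCoeff
  rw [show (k : ℝ) + (ν + 1) + 1 = (k : ℝ) + ν + 1 + 1 by ring, Real.Gamma_add_one h,
    mul_left_comm, mul_inv ((k : ℝ) + ν + 1), mul_inv_cancel_left₀ h]

lemma summable_besselSeries {ν : ℝ} (hν : -1 < ν) (z : ℝ) :
    Summable fun k : ℕ => besselCoeff ν k * z ^ k := by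
  rcases eq_or_ne z 0 with rfl | hz
  · exact summable_of_ne_finset_zero (s := {0}) fun k hk => by
      simp [zero_pow (show k ≠ 0 by simpa using hk)]
  refine summable_of_ratio_test_tendsto_lt_one (l := 0) one_pos
    (.of_forall fun k => mul_ne_zero (besselCoeff_pos hν k).ne' (pow_ne_zero _ hz)) ?_
  have h1 : Tendsto (fun k : ℕ => (k : ℝ) + 1) atTop atTop :=
    tendsto_atTop_add_const_right _ _ tendsto_natCast_atTop_atTop
  have h2 : Tendsto (fun k : ℕ => (k : ℝ) + ν + 1) atTop atTop :=
    tendsto_atTop_add_const_right _ _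
      (tendsto_atTop_add_const_right _ _ tendsto_natCast_atTop_atTop)
  have h3 := (h1.atTop_mul_atTop₀ h2).const_div_atTop |z|
  refine h3.congr fun k => ?_
  have hk : (0 : ℝ) ≤ k := k.cast_nonneg
  have hk2 : (0 : ℝ) < (k : ℝ) + ν + 1 := by linarith
  have hA := succ_mul_besselCoeff_succ ν k
  have hB := mul_besselCoeff_add_one hν k
  have hp := besselCoeff_pos hν k
  have hp' := besselCoeff_pos hν (k + 1)
  have hz' : 0 < |z| := abs_pos.2 hz
  rw [← hA] at hB
  rw [norm_mul, norm_mul, norm_pow, norm_pow, Real.norm_of_nonneg hp.le,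
    Real.norm_of_nonneg hp'.le, Real.norm_eq_abs, ← hB]
  field_simp
  ring

lemma hasSum_besselSeries {ν : ℝ} (hν : -1 < ν) (z : ℝ) :
    HasSum (fun k : ℕ => besselCoeff ν k * z ^ k) (besselSeries ν z) :=
  (summable_besselSeries hν z).hasSum

lemma hasSum_nat_mul_besselCoeff {ν : ℝ} (hν : -1 < ν) (z : ℝ) :
    HasSum (fun k : ℕ => (k : ℝ) * besselCoeff ν k * z ^ k) (z * besselSeries (ν + 1) z) := by
  have h := (hasSum_besselSeries (show -1 < ν + 1 by linarith) z).mul_left z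
  rw [← hasSum_nat_add_iff' 1]
  simp only [Finset.range_one, Finset.sum_singleton, Nat.cast_zero, zero_mul, sub_zero]
  refine h.congr_fun fun k => ?_
  rw [← succ_mul_besselCoeff_succ]
  push_cast
  ring

lemma besselSeries_recurrence {ν : ℝ} (hν : -1 < ν) (z : ℝ) :
    besselSeries ν z = (ν + 1) * besselSeries (ν + 1) z + z * besselSeries (ν + 2) z := by
  have h1 := (hasSum_besselSeries (show -1 < ν + 1 by linarith) z).mul_left (ν + 1)
  have h2 := hasSum_nat_mul_besselCoeff (show -1 < ν + 1 by linarith) z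
  rw [show ν + 1 + 1 = ν + 2 by ring] at h2
  refine ((h1.add h2).congr_fun fun k => ?_).unique (hasSum_besselSeries hν z) |>.symm
  rw [← mul_besselCoeff_add_one hν]
  ring

lemma hasSum_mul_add_besselCoeff {ν : ℝ} (hν : -1 < ν) (z : ℝ) :
    HasSum (fun k : ℕ => (k : ℝ) * (k + ν) * besselCoeff ν k * z ^ k)
      (z * besselSeries ν z) := by
  have h := (hasSum_besselSeries hν z).mul_left z
  rw [← hasSum_nat_add_iff' 1]
  simp only [Finset.range_one, Finset.sum_singleton, Nat.cast_zero, zero_mul, sub_zero]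
  refine h.congr_fun fun k => ?_
  rw [← mul_besselCoeff_add_one hν k, ← succ_mul_besselCoeff_succ ν k]
  push_cast
  ring

lemma hasDerivAt_besselSeries {ν : ℝ} (hν : -1 < ν) (z : ℝ) :
    HasDerivAt (besselSeries ν) (besselSeries (ν + 1) z) z := by
  set r : ℝ := |z| + 1 with hr
  have hr0 : 0 < r := by positivity
  have hu : Summable fun k : ℕ => (k : ℝ) * besselCoeff ν k * r ^ (k - 1) := by
    refine ((hasSum_nat_mul_besselCoeff hν r).summable.mul_left r⁻¹).congr fun k => ?_
    rcases k with _ | k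
    · simp
    · rw [Nat.add_sub_cancel, pow_succ]
      field_simp
  have key := hasDerivAt_tsum_of_isPreconnected
    (u := fun k : ℕ => (k : ℝ) * besselCoeff ν k * r ^ (k - 1))
    (g := fun (k : ℕ) (y : ℝ) => besselCoeff ν k * y ^ k)
    (g' := fun (k : ℕ) (y : ℝ) => besselCoeff ν k * ((k : ℝ) * y ^ (k - 1)))
    (t := Metric.ball 0 r) (y₀ := 0) (y := z) hu Metric.isOpen_ball
    (convex_ball _ _).isPreconnected
    (fun k y _ => (hasDerivAt_pow k y).const_mul _) ?_ (by simpa using hr0)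
    (summable_besselSeries hν 0) (by simp [hr])
  · have hsum : HasSum (fun k : ℕ => besselCoeff ν k * ((k : ℝ) * z ^ (k - 1)))
        (besselSeries (ν + 1) z) := ?_
    · rw [hsum.tsum_eq] at key
      exact key
    rw [← hasSum_nat_add_iff' 1]
    simp only [Finset.range_one, Finset.sum_singleton, Nat.cast_zero, zero_mul, mul_zero, sub_zero]
    refine (hasSum_besselSeries (show -1 < ν + 1 by linarith) z).congr_fun fun k => ?_
    rw [← succ_mul_besselCoeff_succ, Nat.add_sub_cancel]
    push_cast
    ring
  · intro k y hy
    have hy' : |y| ≤ r := by simpa using (mem_ball_zero_iff.1 hy).le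
    have := besselCoeff_pos hν k
    rw [norm_mul, norm_mul, norm_pow, Real.norm_of_nonneg this.le, Real.norm_eq_abs,
      Real.norm_eq_abs, Nat.abs_cast]
    calc _ = (k : ℝ) * besselCoeff ν k * |y| ^ (k - 1) := by ring
      _ ≤ _ := by gcongr

lemma besselCoeff_mul_pow_le {ν z : ℝ} (hν : -1 < ν) (hz : 0 ≤ z) (k : ℕ) :
    besselCoeff ν k * z ^ k ≤ besselSeries ν z :=
  le_hasSum (hasSum_besselSeries hν z) k fun j _ =>
    mul_nonneg (besselCoeff_pos hν j).le (pow_nonneg hz j)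

lemma besselSeries_pos {ν z : ℝ} (hν : -1 < ν) (hz : 0 ≤ z) : 0 < besselSeries ν z :=
  (by simpa using besselCoeff_pos hν 0 : 0 < besselCoeff ν 0 * z ^ 0).trans_le
    (besselCoeff_mul_pow_le hν hz 0)

lemma besselSeries_add_one_le {ν z : ℝ} (hν : -1 < ν) (hz : 1 ≤ z) :
    besselSeries (ν + 1) z ≤ 3 / √z * besselSeries ν z := by
  have hz0 : 0 < z := by linarith
  have hy1 : 1 ≤ √z := Real.one_le_sqrt.2 hz
  have hyy : √z * √z = z := Real.mul_self_sqrt hz0.le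
  set y := √z
  have hy0 : 0 < y := by linarith
  have hg := hasSum_besselSeries hν z
  have hshift := (hasSum_nat_add_iff' 1).2 hg
  have hsum := (hg.mul_left (1 / y)).add (hshift.mul_left ((y + 1) / z))
  have hle : besselSeries (ν + 1) z ≤ _ :=
    hasSum_le (fun k => ?_) (hasSum_besselSeries (show -1 < ν + 1 by linarith) z) hsum
  · have hc := besselCoeff_pos hν 0
    have hG := besselSeries_pos hν hz0.le
    have h2 : (y + 1) / z ≤ 2 / y := by
      rw [div_le_div_iff₀ hz0 hy0]; nlinarith
    calc _ ≤ _ := hle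
      _ ≤ 1 / y * besselSeries ν z + (y + 1) / z * besselSeries ν z := by
        gcongr
        simp [hc.le]
      _ ≤ 1 / y * besselSeries ν z + 2 / y * besselSeries ν z := by gcongr
      _ = _ := by ring
  · have hk0 : (0 : ℝ) ≤ k := k.cast_nonneg
    have hp := besselCoeff_pos (show -1 < ν + 1 by linarith) k
    have hzk : 0 < z ^ k := by positivity
    have h1 : 0 ≤ besselCoeff ν k * z ^ k := by have := besselCoeff_pos hν k; positivity
    have h2 : 0 ≤ besselCoeff ν (k + 1) * z ^ (k + 1) := by
      have := besselCoeff_pos hν (k + 1); positivity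
    rcases le_total y ((k : ℝ) + ν + 1) with h | h
    · have : besselCoeff (ν + 1) k * z ^ k ≤ 1 / y * (besselCoeff ν k * z ^ k) := by
        rw [← mul_besselCoeff_add_one hν k, one_div, inv_mul_eq_div, le_div_iff₀ hy0]
        have := mul_le_mul_of_nonneg_right h (mul_pos hp hzk).le
        nlinarith
      have : 0 ≤ (y + 1) / z * (besselCoeff ν (k + 1) * z ^ (k + 1)) := by positivity
      linarith
    · have : besselCoeff (ν + 1) k * z ^ k ≤
          (y + 1) / z * (besselCoeff ν (k + 1) * z ^ (k + 1)) := by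
        rw [← succ_mul_besselCoeff_succ, pow_succ]
        have h3 : (k : ℝ) + 1 ≤ y + 1 := by linarith
        calc _ ≤ (y + 1) * besselCoeff ν (k + 1) * z ^ k := by
              have := besselCoeff_pos hν (k + 1); gcongr
          _ = _ := by field_simp
      have : 0 ≤ 1 / y * (besselCoeff ν k * z ^ k) := by positivity
      linarith

lemma Gamma_add_le_rpow_mul_Gamma {x θ : ℝ} (hx : 0 < x) (hθ : 0 < θ) (hθ1 : θ < 1) :
    Real.Gamma (x + θ) ≤ x ^ θ * Real.Gamma x := by
  have hG := Real.Gamma_pos_of_pos hx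
  have h := Real.Gamma_mul_add_mul_le_rpow_Gamma_mul_rpow_Gamma hx (show 0 < x + 1 by linarith)
    (show 0 < 1 - θ by linarith) hθ (by ring)
  rw [show (1 - θ) * x + θ * (x + 1) = x + θ by ring, Real.Gamma_add_one hx.ne',
    Real.mul_rpow hx.le hG.le, mul_left_comm, ← Real.rpow_add hG, sub_add_cancel,
    Real.rpow_one] at h
  exact h

lemma one_sub_mul_sub_one_le_inv_rpow {q θ : ℝ} (hq : 0 < q) (hθ : 0 ≤ θ) (hθ1 : θ ≤ 1) :
    1 - θ * (q - 1) ≤ (q ^ θ)⁻¹ := by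
  have h := rpow_one_add_le_one_add_mul_self (show -1 ≤ q - 1 by linarith) hθ hθ1
  rw [add_sub_cancel] at h
  have hp : 0 < q ^ θ := Real.rpow_pos_of_pos hq θ
  have h2 : 2 - q ^ θ ≤ (q ^ θ)⁻¹ := by
    rw [← one_div, le_div_iff₀ hp]
    nlinarith [sq_nonneg (q ^ θ - 1)]
  linarith

/-- Shifting both Gamma arguments by `θ` costs at most a factor tending to `1`: a quantitative
consequence of the logarithmic convexity of `Gamma`. -/
lemma le_rpow_mul_of_hasSum_shift {ν θ z S : ℝ} (hν : -1 < ν) (hν1 : ν ≤ 1) (hθ : 0 < θ)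
    (hθ1 : θ < 1) (hz : 1 ≤ z)
    (hS : HasSum (fun k : ℕ => z ^ k *
      (Real.Gamma ((k : ℝ) + 1 + θ) * Real.Gamma ((k : ℝ) + 1 + ν + θ))⁻¹) S) :
    (1 - 8 / √z) * besselSeries ν z ≤ z ^ θ * S := by
  have hz0 : 0 < z := by linarith
  have hg := hasSum_besselSeries hν z
  have hg1 := hasSum_nat_mul_besselCoeff hν z
  have hg2 := hasSum_mul_add_besselCoeff hν z
  have hlow := (hg.mul_left (1 + θ - θ * (1 + ν) / z)).sub
    ((hg2.add (hg1.mul_left 2)).mul_left (θ / z))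
  have hle := hasSum_le (fun k => ?_) hlow (hS.mul_left (z ^ θ))
  · refine le_trans ?_ hle
    have hG := besselSeries_pos hν hz0.le
    have h3 := besselSeries_add_one_le hν hz
    have hy1 : 1 ≤ √z := Real.one_le_sqrt.2 hz
    have hyy : √z * √z = z := Real.mul_self_sqrt hz0.le
    have h4 : θ * (1 + ν) / z ≤ 2 / √z := by
      rw [div_le_div_iff₀ hz0 (by linarith)]
      have : θ * (1 + ν) ≤ 2 := by nlinarith
      nlinarith
    have h5 : θ / z * (z * besselSeries ν z + 2 * (z * besselSeries (ν + 1) z)) =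
        θ * besselSeries ν z + 2 * (θ * besselSeries (ν + 1) z) := by
      field_simp
    rw [h5]
    have h6 : θ * besselSeries (ν + 1) z ≤ 3 / √z * besselSeries ν z := by
      have := besselSeries_pos (show -1 < ν + 1 by linarith) hz0.le
      nlinarith
    have h7 := mul_le_mul_of_nonneg_right h4 hG.le
    have h8 : (8 : ℝ) / √z = 2 / √z + 2 * (3 / √z) := by ring
    rw [h8]
    linarith
  · have hk0 : (0 : ℝ) ≤ k := k.cast_nonneg
    have hx1 : (0 : ℝ) < (k : ℝ) + 1 := by linarith
    have hx2 : (0 : ℝ) < (k : ℝ) + 1 + ν := by linarith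
    have hG1 := Real.Gamma_pos_of_pos hx1
    have hG2 := Real.Gamma_pos_of_pos hx2
    have hp := besselCoeff_pos hν k
    have hzk : 0 < z ^ k := by positivity
    have hzθ : 0 < z ^ θ := Real.rpow_pos_of_pos hz0 θ
    set q : ℝ := ((k : ℝ) + 1) * ((k : ℝ) + 1 + ν) / z with hq
    have hq0 : 0 < q := by positivity
    have hB := one_sub_mul_sub_one_le_inv_rpow hq0 hθ.le hθ1.le
    have hqθ : q ^ θ = ((k : ℝ) + 1) ^ θ * ((k : ℝ) + 1 + ν) ^ θ / z ^ θ := by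
      rw [hq, Real.div_rpow (by positivity) hz0.le, Real.mul_rpow hx1.le hx2.le]
    have hGam : Real.Gamma ((k : ℝ) + 1 + θ) * Real.Gamma ((k : ℝ) + 1 + ν + θ) ≤
        (((k : ℝ) + 1) ^ θ * Real.Gamma ((k : ℝ) + 1)) *
          (((k : ℝ) + 1 + ν) ^ θ * Real.Gamma ((k : ℝ) + 1 + ν)) :=
      mul_le_mul (Gamma_add_le_rpow_mul_Gamma hx1 hθ hθ1) (Gamma_add_le_rpow_mul_Gamma hx2 hθ hθ1)
        (Real.Gamma_pos_of_pos (by linarith)).le (by positivity)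
    have hcoef : besselCoeff ν k = (Real.Gamma ((k : ℝ) + 1) * Real.Gamma ((k : ℝ) + 1 + ν))⁻¹ := by
      rw [besselCoeff, Real.Gamma_nat_eq_factorial, add_right_comm]
    have hT : (0 : ℝ) < Real.Gamma ((k : ℝ) + 1 + θ) * Real.Gamma ((k : ℝ) + 1 + ν + θ) :=
      mul_pos (Real.Gamma_pos_of_pos (by linarith)) (Real.Gamma_pos_of_pos (by linarith))
    calc _ = (1 - θ * (q - 1)) * (besselCoeff ν k * z ^ k) := by
          rw [hq]; field_simp; ring
      _ ≤ (q ^ θ)⁻¹ * (besselCoeff ν k * z ^ k) := by gcongr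
      _ = z ^ θ * (z ^ k * ((((k : ℝ) + 1) ^ θ * Real.Gamma ((k : ℝ) + 1)) *
          (((k : ℝ) + 1 + ν) ^ θ * Real.Gamma ((k : ℝ) + 1 + ν)))⁻¹) := by
          rw [hqθ, hcoef, inv_div]
          simp only [mul_inv]
          ring
      _ ≤ _ := by gcongr

lemma rpow_mul_besselSeries_lower {μ z : ℝ} (hμ : 0 < μ) (hμ1 : μ < 1) (hz : 1 ≤ z) :
    (1 - 8 / √z) * besselSeries (-μ) z ≤ z ^ μ * besselSeries μ z := by
  refine le_rpow_mul_of_hasSum_shift (by linarith) (by linarith) hμ hμ1 hz ?_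
  refine (hasSum_besselSeries (show -1 < μ by linarith) z).congr_fun fun k => ?_
  rw [besselCoeff, show (k : ℝ) + 1 + -μ + μ = k + 1 by ring, Real.Gamma_nat_eq_factorial,
    add_right_comm (k : ℝ) 1 μ, mul_comm (Real.Gamma _), mul_comm]

lemma rpow_mul_besselSeries_neg_lower {μ z : ℝ} (hμ : 0 < μ) (hμ1 : μ < 1) (hz : 1 ≤ z) :
    (1 - 8 / √z) * besselSeries μ z ≤ z ^ (-μ) * besselSeries (-μ) z := by
  have hz0 : 0 < z := by linarith
  have hν : -1 < -μ := by linarith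
  have hS := ((hasSum_nat_add_iff' 1).2 (hasSum_besselSeries hν z)).mul_left z⁻¹
  have h := le_rpow_mul_of_hasSum_shift (ν := μ) (θ := 1 - μ) (by linarith) hμ1.le
    (by linarith) (by linarith) hz (hS.congr_fun fun k => ?_)
  · refine h.trans ?_
    have hc := besselCoeff_pos hν 0
    rw [sub_eq_neg_add 1 μ, Real.rpow_add hz0, Real.rpow_one, mul_assoc, mul_inv_cancel_left₀ hz0.ne']
    gcongr
    simp [hc.le]
  · have h1 : Real.Gamma ((k : ℝ) + 1 + μ + (1 - μ)) = ((k + 1).factorial : ℝ) := by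
      rw [← Real.Gamma_nat_eq_factorial]
      push_cast
      congr 1
      ring
    rw [h1, besselCoeff, pow_succ, show ((k + 1 : ℕ) : ℝ) + -μ + 1 = (k : ℝ) + 1 + (1 - μ) by
      push_cast; ring]
    field_simp

/-- The quotient `I_{-μ} / I_μ` as a function of `z = (x / 2) ^ 2`. -/
noncomputable def besselQuot (μ z : ℝ) : ℝ := z ^ (-μ) * besselSeries (-μ) z / besselSeries μ z

lemma tendsto_besselQuot {μ : ℝ} (hμ : 0 < μ) (hμ1 : μ < 1) :
    Tendsto (besselQuot μ) atTop (nhds 1) := by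
  have h0 : Tendsto (fun z : ℝ => 1 - 8 / √z) atTop (nhds 1) := by
    simpa using (Real.tendsto_sqrt_atTop.const_div_atTop 8).const_sub 1
  have h1 : Tendsto (fun z : ℝ => (1 - 8 / √z)⁻¹) atTop (nhds 1) := by
    simpa using h0.inv₀ one_ne_zero
  refine tendsto_of_tendsto_of_tendsto_of_le_of_le' h0 h1 ?_ ?_
  · filter_upwards [eventually_ge_atTop 1] with z hz
    rw [besselQuot, le_div_iff₀ (besselSeries_pos (by linarith) (by linarith))]
    exact rpow_mul_besselSeries_neg_lower hμ hμ1 hz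
  · filter_upwards [eventually_ge_atTop 1, h0.eventually_const_lt one_pos] with z hz hpos
    have hz0 : 0 < z := by linarith
    have hzμ : 0 < z ^ μ := Real.rpow_pos_of_pos hz0 μ
    rw [besselQuot, div_le_iff₀ (besselSeries_pos (by linarith) hz0.le), inv_mul_eq_div,
      le_div_iff₀ hpos, Real.rpow_neg hz0.le, mul_assoc, inv_mul_le_iff₀ hzμ, mul_comm _ (1 - _)]
    exact rpow_mul_besselSeries_lower hμ hμ1 hz

lemma besselSeries_wronskian {μ : ℝ} (hμ : 0 < μ) (hμ1 : μ < 1) (z : ℝ) :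
    z * (besselSeries (1 - μ) z * besselSeries μ z - besselSeries (-μ) z * besselSeries (μ + 1) z)
      - μ * (besselSeries (-μ) z * besselSeries μ z) =
    -(μ * (besselSeries (-μ) 0 * besselSeries μ 0)) := by
  let W : ℝ → ℝ := fun z =>
    z * (besselSeries (1 - μ) z * besselSeries μ z - besselSeries (-μ) z * besselSeries (μ + 1) z)
      - μ * (besselSeries (-μ) z * besselSeries μ z)
  have hW : ∀ z, HasDerivAt W 0 z := fun z => by
    have d1 := hasDerivAt_besselSeries (show -1 < -μ by linarith) z
    have d2 := hasDerivAt_besselSeries (show -1 < μ by linarith) z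
    have d3 := hasDerivAt_besselSeries (show -1 < 1 - μ by linarith) z
    have d4 := hasDerivAt_besselSeries (show -1 < μ + 1 by linarith) z
    have r1 := besselSeries_recurrence (show -1 < -μ by linarith) z
    have r2 := besselSeries_recurrence (show -1 < μ by linarith) z
    rw [show -μ + 1 = 1 - μ by ring] at d1 r1
    rw [show 1 - μ + 1 = -μ + 2 by ring] at d3
    rw [show μ + 1 + 1 = μ + 2 by ring] at d4
    have d := ((hasDerivAt_id z).mul ((d3.mul d2).sub (d1.mul d4))).sub ((d1.mul d2).const_mul μ)
    refine d.congr_deriv ?_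
    simp only [id, Pi.sub_apply, Pi.mul_apply]
    linear_combination (-besselSeries μ z) * r1 + besselSeries (-μ) z * r2
  have h := is_const_of_deriv_eq_zero (fun z => (hW z).differentiableAt) (fun z => (hW z).deriv) z 0
  simpa [W] using h

lemma hasDerivAt_besselQuot {μ z : ℝ} (hμ : 0 < μ) (hμ1 : μ < 1) (hz : 0 < z) :
    HasDerivAt (besselQuot μ)
      (-(μ * (besselSeries (-μ) 0 * besselSeries μ 0)) * z ^ (-μ - 1) / besselSeries μ z ^ 2) z := by
  have d1 := hasDerivAt_besselSeries (show -1 < -μ by linarith) z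
  have d2 := hasDerivAt_besselSeries (show -1 < μ by linarith) z
  rw [show -μ + 1 = 1 - μ by ring] at d1
  have d0 := Real.hasDerivAt_rpow_const (x := z) (p := -μ) (Or.inl hz.ne')
  have hpos := besselSeries_pos (show -1 < μ by linarith) hz.le
  refine ((d0.mul d1).div d2 hpos.ne').congr_deriv ?_
  rw [← besselSeries_wronskian hμ hμ1 z]
  have hzp : z ^ (-μ) = z ^ (-μ - 1) * z := by
    rw [← Real.rpow_add_one hz.ne', sub_add_cancel]
  simp only [Pi.mul_apply, hzp]
  ring

lemma one_le_besselQuot {μ z : ℝ} (hμ : 0 < μ) (hμ1 : μ < 1) (hz : 0 < z) :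
    1 ≤ besselQuot μ z := by
  have hanti : AntitoneOn (besselQuot μ) (Set.Ioi 0) := by
    refine antitoneOn_of_deriv_nonpos (convex_Ioi 0)
      (fun x hx => (hasDerivAt_besselQuot hμ hμ1 hx).continuousAt.continuousWithinAt)
      (fun x hx => (hasDerivAt_besselQuot hμ hμ1
        (interior_subset hx)).differentiableAt.differentiableWithinAt) fun x hx => ?_
    rw [interior_Ioi] at hx
    have h1 := besselSeries_pos (show -1 < -μ by linarith) le_rfl
    have h2 := besselSeries_pos (show -1 < μ by linarith) le_rfl
    have h3 := besselSeries_pos (show -1 < μ by linarith) (le_of_lt hx)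
    have h4 : 0 < x ^ (-μ - 1) := Real.rpow_pos_of_pos hx _
    rw [(hasDerivAt_besselQuot hμ hμ1 hx).deriv, neg_mul, neg_div, neg_nonpos]
    positivity
  refine le_of_tendsto (tendsto_besselQuot hμ hμ1) ?_
  filter_upwards [eventually_ge_atTop z] with y hy
  exact hanti hz (Set.mem_Ioi.2 (hz.trans_le hy)) hy

/-- `I_{-μ} / I_μ - 1` decays faster than any power. -/
lemma exists_besselQuot_le {μ : ℝ} (hμ : 0 < μ) (hμ1 : μ < 1) (N : ℕ) :
    ∃ C : ℝ, 0 ≤ C ∧ ∀ z : ℝ, 0 < z → besselQuot μ z ≤ 1 + C * z ^ (-μ - 2 * N) := by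
  have h1 := besselSeries_pos (show -1 < -μ by linarith) le_rfl
  have h2 := besselSeries_pos (show -1 < μ by linarith) le_rfl
  set w : ℝ := μ * (besselSeries (-μ) 0 * besselSeries μ 0) with hw
  have hw0 : 0 < w := by positivity
  set c := besselCoeff μ N with hc
  have hc0 : 0 < c := besselCoeff_pos (by linarith) N
  have hN : (0 : ℝ) < μ + 2 * N := by positivity
  set C : ℝ := w / c ^ 2 / (μ + 2 * N) with hC
  have hd : ∀ z : ℝ, 0 < z → HasDerivAt (fun z => besselQuot μ z - C * z ^ (-μ - 2 * N))
      (-w * z ^ (-μ - 1) / besselSeries μ z ^ 2 + w / c ^ 2 * z ^ (-μ - 2 * N - 1)) z :=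
    fun z hz => by
      refine ((hasDerivAt_besselQuot hμ hμ1 hz).sub
        ((Real.hasDerivAt_rpow_const (p := -μ - 2 * N) (Or.inl hz.ne')).const_mul C)).congr_deriv ?_
      rw [hC]
      field_simp
      ring
  have hmono : MonotoneOn (fun z => besselQuot μ z - C * z ^ (-μ - 2 * N)) (Set.Ioi 0) := by
    refine monotoneOn_of_deriv_nonneg (convex_Ioi 0)
      (fun x hx => (hd x hx).continuousAt.continuousWithinAt)
      (fun x hx => (hd x (interior_subset hx)).differentiableAt.differentiableWithinAt)
      fun x hx => ?_
    rw [interior_Ioi] at hx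
    have hx0 : 0 < x := hx
    have hle := besselCoeff_mul_pow_le (show -1 < μ by linarith) hx0.le N
    have h4 : 0 < x ^ (-μ - 1) := Real.rpow_pos_of_pos hx0 _
    rw [(hd x hx0).deriv]
    have hpow : x ^ (-μ - 2 * N - 1) = x ^ (-μ - 1) / (x ^ N) ^ 2 := by
      rw [show -μ - 2 * N - 1 = -μ - 1 - ((N * 2 : ℕ) : ℝ) by push_cast; ring,
        Real.rpow_sub_natCast hx0.ne', pow_mul]
    have : w * x ^ (-μ - 1) / besselSeries μ x ^ 2 ≤ w * x ^ (-μ - 1) / (c * x ^ N) ^ 2 := by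
      gcongr
    have h5 : w / c ^ 2 * x ^ (-μ - 2 * N - 1) = w * x ^ (-μ - 1) / (c * x ^ N) ^ 2 := by
      rw [hpow]; field_simp
    rw [h5, neg_mul, neg_div]
    linarith
  refine ⟨C, by positivity, fun z hz => ?_⟩
  have hlim : Tendsto (fun z => besselQuot μ z - C * z ^ (-μ - 2 * N)) atTop (nhds 1) := by
    have := tendsto_rpow_neg_atTop hN
    rw [show -(μ + 2 * N) = -μ - 2 * N by ring] at this
    simpa using (tendsto_besselQuot hμ hμ1).sub (this.const_mul C)
  have := ge_of_tendsto hlim (b := besselQuot μ z - C * z ^ (-μ - 2 * N)) (by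
    filter_upwards [eventually_ge_atTop z] with y hy
    exact hmono hz (Set.mem_Ioi.2 (hz.trans_le hy)) hy)
  linarith

lemma besselI_eq {ν x : ℝ} (hx : 0 < x) :
    besselI ν x = (x / 2) ^ ν * besselSeries ν ((x / 2) ^ 2) := by
  have hx2 : 0 < x / 2 := by positivity
  rw [besselI, besselSeries, ← tsum_mul_left]
  refine tsum_congr fun k => ?_
  rw [besselCoeff, Real.rpow_add hx2, ← pow_mul,
    show (2 : ℝ) * k = ((2 * k : ℕ) : ℝ) by push_cast; ring, Real.rpow_natCast, div_eq_mul_inv]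
  ring

lemma besselI_div {μ x : ℝ} (hx : 0 < x) :
    besselI μ x / besselI (-μ) x = (besselQuot μ ((x / 2) ^ 2))⁻¹ := by
  have hx2 : 0 < x / 2 := by positivity
  rw [besselI_eq hx, besselI_eq hx, besselQuot, inv_div, ← Real.rpow_natCast, ← Real.rpow_mul hx2.le,
    show ((2 : ℕ) : ℝ) * -μ = -μ + -μ by push_cast; ring, Real.rpow_add hx2, Real.rpow_neg hx2.le]
  have : (x / 2) ^ μ ≠ 0 := (Real.rpow_pos_of_pos hx2 μ).ne'
  field_simp

lemma Cs_pos {s : ℝ} (hs : s ∈ Set.Ioo (0 : ℝ) 1) : 0 < Cs s := by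
  have h1 := Real.Gamma_pos_of_pos hs.1
  have h2 := Real.Gamma_pos_of_pos (sub_pos.2 hs.2)
  unfold Cs
  positivity

lemma Stilde_eq {n : ℕ} (s : ℝ) {ξ : EuclideanSpace ℝ (Fin n)} (hξ : ξ ≠ 0) :
    Stilde s ξ = Cs s * (besselQuot (1 - s) ((‖ξ‖ / 2) ^ 2))⁻¹ := by
  rw [Stilde, if_neg hξ, ← besselI_div (norm_pos_iff.2 hξ), neg_sub, mul_div_assoc]

lemma Stilde_nonneg {n : ℕ} {s : ℝ} (hs : s ∈ Set.Ioo (0 : ℝ) 1)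
    (ξ : EuclideanSpace ℝ (Fin n)) : 0 ≤ Stilde s ξ := by
  rcases eq_or_ne ξ 0 with rfl | hξ
  · simp [Stilde]
  have hpos : 0 < ‖ξ‖ := norm_pos_iff.2 hξ
  have hC := Cs_pos hs
  have := one_le_besselQuot (sub_pos.2 hs.2) (sub_lt_self 1 hs.1)
    (show 0 < (‖ξ‖ / 2) ^ 2 by positivity)
  rw [Stilde_eq s hξ]
  positivity

lemma Stilde_le_Cs {n : ℕ} {s : ℝ} (hs : s ∈ Set.Ioo (0 : ℝ) 1)
    (ξ : EuclideanSpace ℝ (Fin n)) : Stilde s ξ ≤ Cs s := by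
  have hC := Cs_pos hs
  rcases eq_or_ne ξ 0 with rfl | hξ
  · simpa [Stilde] using hC.le
  have hpos : 0 < ‖ξ‖ := norm_pos_iff.2 hξ
  rw [Stilde_eq s hξ]
  exact mul_le_of_le_one_right hC.le (inv_le_one_of_one_le₀
    (one_le_besselQuot (sub_pos.2 hs.2) (sub_lt_self 1 hs.1) (by positivity)))

lemma exists_Cs_sub_Stilde_le {s : ℝ} (hs : s ∈ Set.Ioo (0 : ℝ) 1) (N : ℕ) :
    ∃ C : ℝ, 0 ≤ C ∧ ∀ {n : ℕ} (ξ : EuclideanSpace ℝ (Fin n)), 1 ≤ ‖ξ‖ →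
      Cs s - Stilde s ξ ≤ C * ‖ξ‖ ^ (-(4 * N : ℝ)) := by
  have hμ := sub_pos.2 hs.2
  have hμ1 := sub_lt_self 1 hs.1
  obtain ⟨C, hC, hle⟩ := exists_besselQuot_le hμ hμ1 N
  have hCs := Cs_pos hs
  refine ⟨Cs s * (C * (2 ^ (-2 * (-(1 - s) - 2 * N)))), by positivity, fun ξ hξ => ?_⟩
  have hpos : 0 < ‖ξ‖ := by linarith
  have hz : 0 < (‖ξ‖ / 2) ^ 2 := by positivity
  rw [Stilde_eq s (norm_pos_iff.1 hpos)]
  have h1 := one_le_besselQuot hμ hμ1 hz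
  have h2 := hle _ hz
  set R := besselQuot (1 - s) ((‖ξ‖ / 2) ^ 2)
  have h3 : 1 - R⁻¹ ≤ R - 1 := by
    have : R * R⁻¹ = 1 := mul_inv_cancel₀ (by linarith)
    nlinarith [sq_nonneg (R - 1), inv_pos.2 (show 0 < R by linarith)]
  have h4 : ((‖ξ‖ / 2) ^ 2) ^ (-(1 - s) - 2 * N) ≤
      2 ^ (-2 * (-(1 - s) - 2 * N)) * ‖ξ‖ ^ (-(4 * N : ℝ)) := by
    rw [← Real.rpow_natCast, ← Real.rpow_mul (by positivity), Real.div_rpow hpos.le zero_le_two,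
      div_eq_mul_inv, ← Real.rpow_neg zero_le_two, mul_comm]
    push_cast
    rw [neg_mul]
    gcongr
    linarith
  calc _ = Cs s * (1 - R⁻¹) := by ring
    _ ≤ Cs s * (C * (2 ^ (-2 * (-(1 - s) - 2 * N)) * ‖ξ‖ ^ (-(4 * N : ℝ)))) := by
      gcongr
      exact h3.trans ((by linarith : R - 1 ≤ _).trans (mul_le_mul_of_nonneg_left h4 hC))
    _ = _ := by ring

/-- Key finiteness claim (equation (finite:int)) in the proof of Lemma 4.1:
`∫_{ℝⁿ} (C_s - S̃_s(ξ)) |ξ|^{2s} dξ < +∞`, the integrand being nonnegative since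
`S̃_s(ξ) ≤ C_s` for all `ξ`. -/
theorem stmt6 (n : ℕ) (hn : 1 ≤ n) (s : ℝ) (hs : s ∈ Set.Ioo (0 : ℝ) 1) :
    (∀ ξ : EuclideanSpace ℝ (Fin n), Stilde s ξ ≤ Cs s) ∧
    ∫⁻ ξ : EuclideanSpace ℝ (Fin n),
        ENNReal.ofReal ((Cs s - Stilde s ξ) * ‖ξ‖ ^ (2 * s)) < ⊤ := by
  refine ⟨Stilde_le_Cs hs, ?_⟩
  obtain ⟨C, hC, hle⟩ := exists_Cs_sub_Stilde_le hs (n + 1)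
  have hCs := Cs_pos hs
  have hfin := finite_integral_one_add_norm (μ := (volume : Measure (EuclideanSpace ℝ (Fin n))))
    (r := n + 1) (by simp)
  have hbound : ∀ ξ : EuclideanSpace ℝ (Fin n), (Cs s - Stilde s ξ) * ‖ξ‖ ^ (2 * s) ≤
      (Cs s + C) * 2 ^ (n + 1 : ℝ) * (1 + ‖ξ‖) ^ (-(n + 1 : ℝ)) := fun ξ => by
    have hξ0 := norm_nonneg ξ
    have hn0 : (0 : ℝ) ≤ n := n.cast_nonneg
    have h0 := Stilde_nonneg hs ξ
    have h1 := Stilde_le_Cs hs ξ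
    have hr : (2 : ℝ) ^ (n + 1 : ℝ) * (1 + ‖ξ‖) ^ (-(n + 1 : ℝ)) =
        ((1 + ‖ξ‖) / 2) ^ (-(n + 1 : ℝ)) := by
      rw [Real.div_rpow (by positivity) zero_le_two, Real.rpow_neg zero_le_two, div_inv_eq_mul,
        mul_comm]
    rw [mul_assoc, hr]
    rcases le_total ‖ξ‖ 1 with h | h
    · have h2 : 1 ≤ ((1 + ‖ξ‖) / 2) ^ (-(n + 1 : ℝ)) :=
        Real.one_le_rpow_of_pos_of_le_one_of_nonpos (by positivity) (by linarith) (by linarith)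
      have h3 : ‖ξ‖ ^ (2 * s) ≤ 1 := Real.rpow_le_one hξ0 h (by linarith [hs.1])
      calc _ ≤ (Cs s + C) * 1 := by
            refine mul_le_mul (by linarith) h3 (by positivity) (by positivity)
        _ ≤ _ := by gcongr
    · have hpos : 0 < ‖ξ‖ := by linarith
      calc _ ≤ C * ‖ξ‖ ^ (-(4 * ((n + 1 : ℕ) : ℝ))) * ‖ξ‖ ^ (2 * s) := by
            gcongr
            exact hle ξ h
        _ = C * ‖ξ‖ ^ (-(4 * ((n + 1 : ℕ) : ℝ)) + 2 * s) := by
            rw [Real.rpow_add hpos, mul_assoc]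
        _ ≤ C * ‖ξ‖ ^ (-(n + 1 : ℝ)) := by
            gcongr
            push_cast
            linarith [hs.2]
        _ ≤ (Cs s + C) * ((1 + ‖ξ‖) / 2) ^ (-(n + 1 : ℝ)) := by
            refine mul_le_mul (by linarith) ?_ (by positivity) (by positivity)
            exact Real.rpow_le_rpow_of_nonpos (by positivity) (by linarith) (by linarith)
  calc _ ≤ ∫⁻ ξ : EuclideanSpace ℝ (Fin n), ENNReal.ofReal ((Cs s + C) * 2 ^ (n + 1 : ℝ)) *
          ENNReal.ofReal ((1 + ‖ξ‖) ^ (-(n + 1 : ℝ))) :=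
        lintegral_mono fun ξ => by
          rw [← ENNReal.ofReal_mul (by positivity)]
          exact ENNReal.ofReal_le_ofReal (hbound ξ)
    _ = ENNReal.ofReal ((Cs s + C) * 2 ^ (n + 1 : ℝ)) *
          ∫⁻ ξ : EuclideanSpace ℝ (Fin n), ENNReal.ofReal ((1 + ‖ξ‖) ^ (-(n + 1 : ℝ))) :=
        lintegral_const_mul' _ _ ENNReal.ofReal_ne_top
    _ < ⊤ := ENNReal.mul_lt_top ENNReal.ofReal_lt_top hfin
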